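/- For every j ∈ {2,3,4} and λ ∈ {1,-1}, it is not the case that L₁N(s,t,w) = 0 for all (s,t,w) ∈ ℝ³. In other words, no tubular hypersurface obtained by pseudo hyperspheres or pseudo hyperbolic hyperspheres whose centers lie on a spacelike curve with non-null Frenet vector fields in E⁴₁ has L₁-harmonic Gauss map. -/

import Mathlib

noncomputable section

open Real

set_option linter.unusedVariables false

/-- Minkowski inner product on `ℝ⁴` with signature `(-,+,+,+)`. -/
def mink (u v : Fin 4 → ℝ) : ℝ :=
  -(u 0 * v 0) + u 1 * v 1 + u 2 * v 2 + u 3 * v 3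

/-- `εᵢ = ⟨Fᵢ,Fᵢ⟩` : equals `-1` if `i = j` and `1` otherwise. -/
def eps (j i : ℕ) : ℝ := if i = j then -1 else 1

/-- `σ = 1` if `j = 2` and `σ = -1` if `j ∈ {3,4}`. -/
def sigma' (j : ℕ) : ℝ := if j = 2 then 1 else -1

/-- `τ = 1` if `j ∈ {2,3}` and `τ = -1` if `j = 4`. -/
def tau' (j : ℕ) : ℝ := if j = 4 then -1 else 1

/-- The functions `μ₂, μ₃, μ₄` defined by the cyclic index rule
(`μ₅ := μ₂`, `μ₆ := μ₃`): `μⱼ = cosh t·sinh w`, `μⱼ₊₁ = cosh w`,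
`μⱼ₊₂ = sinh t·sinh w` if `λ = 1`, and `μⱼ = cosh t·cosh w`,
`μⱼ₊₁ = sinh w`, `μⱼ₊₂ = sinh t·cosh w` if `λ = -1`. -/
def mu (j : ℕ) (lam : ℝ) (i : ℕ) (t w : ℝ) : ℝ :=
  if (i + 3 - j) % 3 = 0 then cosh t * (if lam = 1 then sinh w else cosh w)
  else if (i + 3 - j) % 3 = 1 then (if lam = 1 then cosh w else sinh w)
  else sinh t * (if lam = 1 then sinh w else cosh w)

/-- Gauss map of the tubular hypersurface `T^{j,λ}` about a spacelike curve of type `j`. -/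
def gaussNJ (j : ℕ) (lam : ℝ) (F₂ F₃ F₄ : ℝ → Fin 4 → ℝ) (s t w : ℝ) : Fin 4 → ℝ :=
  (-(sigma' j) * lam ^ j) •
    (mu j lam 2 t w • F₂ s + mu j lam 3 t w • F₃ s + mu j lam 4 t w • F₄ s)

/-- The tubular hypersurface `T^{j,λ}` about a spacelike curve of type `j`. -/
def tubeTJ (j : ℕ) (lam r : ℝ) (β F₂ F₃ F₄ : ℝ → Fin 4 → ℝ) (s t w : ℝ) : Fin 4 → ℝ :=
  β s + r • (mu j lam 2 t w • F₂ s + mu j lam 3 t w • F₃ s + mu j lam 4 t w • F₄ s)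

/-- The function `D(s,t,w) = σ + r k₁(s) μ₂(t,w)`. -/
def DJ (j : ℕ) (lam r : ℝ) (k₁ : ℝ → ℝ) (s t w : ℝ) : ℝ :=
  sigma' j + r * k₁ s * mu j lam 2 t w

/-- The Cheng–Yau operator `ℒ₁` applied to the Gauss map of `T^{j,λ}`. -/
def L1NJ (j : ℕ) (lam r : ℝ) (k₁ k₂ : ℝ → ℝ) (F₁ F₂ F₃ F₄ : ℝ → Fin 4 → ℝ)
    (s t w : ℝ) : Fin 4 → ℝ :=
  (2 * (-(tau' j) * k₁ s * k₂ s * mu j lam 3 t w + deriv k₁ s * mu j lam 2 t w)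
      / (r * (DJ j lam r k₁ s t w) ^ 3)) • F₁ s
  + (-2 * lam * (mu j lam 2 t w + 3 * r ^ 2 * (k₁ s) ^ 2 * (mu j lam 2 t w) ^ 3
      + k₁ s * (lam * r + 4 * sigma' j * r * (mu j lam 2 t w) ^ 2))
      / (r ^ 3 * (DJ j lam r k₁ s t w) ^ 2)) • F₂ s
  + (-2 * lam * sigma' j * mu j lam 3 t w * (1 + 3 * sigma' j * r * k₁ s * mu j lam 2 t w)
      / (r ^ 3 * DJ j lam r k₁ s t w)) • F₃ s
  + (-2 * lam * mu j lam 4 t w * (sigma' j + 3 * r * k₁ s * mu j lam 2 t w)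
      / (r ^ 3 * DJ j lam r k₁ s t w)) • F₄ s

/-- The operator `ℒ₂` applied to the Gauss map of `T^{j,λ}`. -/
def L2NJ (j : ℕ) (lam r : ℝ) (k₁ k₂ : ℝ → ℝ) (F₁ F₂ F₃ F₄ : ℝ → Fin 4 → ℝ)
    (s t w : ℝ) : Fin 4 → ℝ :=
  (lam ^ j * ((-1 : ℝ) ^ j * mu j lam 3 t w * k₁ s * k₂ s - sigma' j * mu j lam 2 t w * deriv k₁ s)
      / (r ^ 2 * (DJ j lam r k₁ s t w) ^ 3)) • F₁ s
  + (-lam ^ (j + 1) * k₁ s * (2 * lam * sigma' j - 3 * (-1 : ℝ) ^ j * (mu j lam 4 t w) ^ 2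
      - 3 * tau' j * (mu j lam 3 t w) ^ 2 - 3 * sigma' j * r * k₁ s * (mu j lam 2 t w) ^ 3)
      / (r ^ 3 * (DJ j lam r k₁ s t w) ^ 2)) • F₂ s
  + (3 * tau' j * lam ^ (j + 1) * r * k₁ s * mu j lam 2 t w * mu j lam 3 t w
      / (r ^ 4 * (tau' j + (-1 : ℝ) ^ j * r * k₁ s * mu j lam 2 t w))) • F₃ s
  + (3 * tau' j * lam ^ (j + 1) * r * k₁ s * mu j lam 2 t w * mu j lam 4 t w
      / (r ^ 4 * (tau' j + (-1 : ℝ) ^ j * r * k₁ s * mu j lam 2 t w))) • F₄ s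

lemma mink_add_left (u v w : Fin 4 → ℝ) : mink (u + v) w = mink u w + mink v w := by
  simp only [mink, Pi.add_apply]
  ring

lemma mink_smul_left (c : ℝ) (u v : Fin 4 → ℝ) : mink (c • u) v = c * mink u v := by
  simp only [mink, Pi.smul_apply, smul_eq_mul]
  ring

lemma mink_zero_left (v : Fin 4 → ℝ) : mink 0 v = 0 := by
  simp [mink]

lemma eps_ne_zero (j i : ℕ) : eps j i ≠ 0 := by
  unfold eps
  split_ifs <;> norm_num

lemma sigma'_ne_zero (j : ℕ) : sigma' j ≠ 0 := by
  unfold sigma'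
  split_ifs <;> norm_num

lemma mu_pos (j : ℕ) (lam : ℝ) (i : ℕ) {t w : ℝ} (ht : 0 < t) (hw : 0 < w) :
    0 < mu j lam i t w := by
  have h₁ := sinh_pos_iff.2 ht
  have h₂ := sinh_pos_iff.2 hw
  have h₃ := cosh_pos t
  have h₄ := cosh_pos w
  unfold mu
  split_ifs <;> positivity

/-- Each `μᵢ` is strictly increasing along the diagonal `t = w > 0`. -/
lemma mu_diag_lt (j : ℕ) (lam : ℝ) (i : ℕ) {a b : ℝ} (ha : 0 < a) (hab : a < b) :
    mu j lam i a a < mu j lam i b b := by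
  have h₁ : sinh a < sinh b := sinh_lt_sinh.2 hab
  have h₂ : cosh a < cosh b := by
    rwa [cosh_lt_cosh, abs_of_pos ha, abs_of_pos (ha.trans hab)]
  have h₃ := sinh_pos_iff.2 ha
  have h₄ := cosh_pos a
  unfold mu
  split_ifs <;> first | assumption | (apply mul_lt_mul'' <;> first | assumption | exact le_of_lt ‹_›)

theorem no_L1_harmonic_gauss_map_spacelike
    (j : ℕ) (hj : j = 2 ∨ j = 3 ∨ j = 4) (lam : ℝ) (hlam : lam = 1 ∨ lam = -1)
    (r : ℝ) (hr : 0 < r)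
    (β F₁ F₂ F₃ F₄ : ℝ → Fin 4 → ℝ) (k₁ k₂ k₃ : ℝ → ℝ)
    (hβ : ContDiff ℝ (⊤ : ℕ∞) β) (hF₁ : ContDiff ℝ (⊤ : ℕ∞) F₁) (hF₂ : ContDiff ℝ (⊤ : ℕ∞) F₂)
    (hF₃ : ContDiff ℝ (⊤ : ℕ∞) F₃) (hF₄ : ContDiff ℝ (⊤ : ℕ∞) F₄)
    (hk₁ : ContDiff ℝ (⊤ : ℕ∞) k₁) (hk₂ : ContDiff ℝ (⊤ : ℕ∞) k₂) (hk₃ : ContDiff ℝ (⊤ : ℕ∞) k₃)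
    (hβ' : ∀ s, deriv β s = F₁ s)
    (hF₁₁ : ∀ s, mink (F₁ s) (F₁ s) = eps j 1)
    (hF₂₂ : ∀ s, mink (F₂ s) (F₂ s) = eps j 2)
    (hF₃₃ : ∀ s, mink (F₃ s) (F₃ s) = eps j 3)
    (hF₄₄ : ∀ s, mink (F₄ s) (F₄ s) = eps j 4)
    (hF₁₂ : ∀ s, mink (F₁ s) (F₂ s) = 0)
    (hF₁₃ : ∀ s, mink (F₁ s) (F₃ s) = 0)
    (hF₁₄ : ∀ s, mink (F₁ s) (F₄ s) = 0)
    (hF₂₃ : ∀ s, mink (F₂ s) (F₃ s) = 0)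
    (hF₂₄ : ∀ s, mink (F₂ s) (F₄ s) = 0)
    (hF₃₄ : ∀ s, mink (F₃ s) (F₄ s) = 0)
    (hFr₁ : ∀ s, deriv F₁ s = k₁ s • F₂ s)
    (hFr₂ : ∀ s, deriv F₂ s = (-(eps j 1 * eps j 2) * k₁ s) • F₁ s + k₂ s • F₃ s)
    (hFr₃ : ∀ s, deriv F₃ s = (-(eps j 2 * eps j 3) * k₂ s) • F₂ s + k₃ s • F₄ s)
    (hFr₄ : ∀ s, deriv F₄ s = (-(eps j 3 * eps j 4) * k₃ s) • F₃ s)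
    (hD : ∀ s t w : ℝ, DJ j lam r k₁ s t w ≠ 0)
    :
    ¬ ∀ s t w : ℝ, L1NJ j lam r k₁ k₂ F₁ F₂ F₃ F₄ s t w = 0 := by
  intro h
  have hlam₀ : lam ≠ 0 := by
    rcases hlam with rfl | rfl <;> norm_num
  have key : ∀ a : ℝ, 0 < a → sigma' j + 3 * r * k₁ 0 * mu j lam 2 a a = 0 := by
    intro a ha
    have h₄ : mink (L1NJ j lam r k₁ k₂ F₁ F₂ F₃ F₄ 0 a a) (F₄ 0) = 0 := by
      rw [h, mink_zero_left]
    simp only [L1NJ, mink_add_left, mink_smul_left, hF₁₄, hF₂₄, hF₃₄, hF₄₄, mul_zero,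
      zero_add] at h₄
    have hden : r ^ 3 * DJ j lam r k₁ 0 a a ≠ 0 := mul_ne_zero (pow_ne_zero 3 hr.ne') (hD 0 a a)
    have hnum := (div_eq_zero_iff.1 ((mul_eq_zero.1 h₄).resolve_right
      (eps_ne_zero j 4))).resolve_right hden
    exact (mul_eq_zero.1 hnum).resolve_left
      (mul_ne_zero (mul_ne_zero (by norm_num) hlam₀) (mu_pos j lam 4 ha ha).ne')
  have hk : 3 * r * k₁ 0 = 0 := by
    have hlt := mu_diag_lt j lam 2 one_pos one_lt_two
    refine (mul_eq_zero.1 ?_).resolve_right (sub_pos.2 hlt).ne'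
    linear_combination key 2 two_pos - key 1 one_pos
  have hσ := key 1 one_pos
  rw [hk, zero_mul, add_zero] at hσ
  exact sigma'_ne_zero j hσ
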